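/- Let ⟨−,−⟩: H ⊗ K → k be a dual pairing of Hopf algebras over a field k and let C be a left partial K-comodule coalgebra with coaction λ(c) = c⁽⁻¹⁾ ⊗ c⁽⁰⁾. Then the map C ⊗ H → C, c ⊗ h ↦ c·h := ⟨h, c⁽⁻¹⁾⟩c⁽⁰⁾, makes C a right partial H-module coalgebra, i.e. it satisfies (PRHMC1), (PRHMC2) and (PRHMC3); if the partial coaction is symmetric (satisfies (PLHCC3')) then the partial action is symmetric (satisfies (PRHMC3')). -/

import Mathlib

open TensorProduct

/-- `sw2 k f g` is the Sweedler-style map `h ↦ ∑ f(h₍₁₎) * g(h₍₂₎)`. -/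
noncomputable def sw2 (k : Type*) [Field k] {H A : Type*}
    [AddCommGroup H] [Module k H] [Coalgebra k H]
    [Ring A] [Algebra k A] (f g : H →ₗ[k] A) : H →ₗ[k] A :=
  TensorProduct.lift ((LinearMap.mul k A).compl₁₂ f g) ∘ₗ Coalgebra.comul
/-- `sw4 k f₁ f₂ h c = ∑ f₁(h₍₁₎ ⊗ c₍₁₎) ⊗ f₂(h₍₂₎ ⊗ c₍₂₎)` in Sweedler notation. -/
noncomputable def sw4 (k : Type*) [Field k] {H C M N : Type*}
    [AddCommGroup H] [Module k H] [Coalgebra k H]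
    [AddCommGroup C] [Module k C] [Coalgebra k C]
    [AddCommGroup M] [Module k M] [AddCommGroup N] [Module k N]
    (f₁ : H ⊗[k] C →ₗ[k] M) (f₂ : H ⊗[k] C →ₗ[k] N) (h : H) (c : C) : M ⊗[k] N :=
  (TensorProduct.map f₁ f₂)
    ((TensorProduct.tensorTensorTensorComm k H H C C)
      ((Coalgebra.comul (R := k) h) ⊗ₜ[k] (Coalgebra.comul (R := k) c)))
/-- A dual pairing of Hopf algebras `⟨-,-⟩ : H ⊗ K → k`:
`⟨hh',x⟩ = ∑ ⟨h,x₍₁₎⟩⟨h',x₍₂₎⟩`, `⟨1,x⟩ = ε(x)`, `⟨h,xy⟩ = ∑ ⟨h₍₁₎,x⟩⟨h₍₂₎,y⟩`, `⟨h,1⟩ = ε(h)`. -/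
structure IsHopfPairing (k : Type*) [Field k] {H K : Type*} [Ring H] [HopfAlgebra k H]
    [Ring K] [HopfAlgebra k K] (p : H →ₗ[k] K →ₗ[k] k) : Prop where
  mul_left : ∀ (h h' : H) (x : K), p (h * h') x = sw2 k (p h) (p h') x
  one_left : ∀ x : K, p 1 x = Coalgebra.counit x
  mul_right : ∀ (h : H) (x y : K), p h (x * y) = sw2 k (p.flip x) (p.flip y) h
  one_right : ∀ h : H, p h 1 = Coalgebra.counit h
/-- The map `H ⊗ C → H`, `x ⊗ c ↦ ε(c)x`. -/
noncomputable def psiHC (k : Type*) [Field k] {H C : Type*}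
    [AddCommGroup H] [Module k H]
    [AddCommGroup C] [Module k C] [Coalgebra k C] : H ⊗[k] C →ₗ[k] H :=
  (TensorProduct.rid k H).toLinearMap ∘ₗ TensorProduct.map LinearMap.id Coalgebra.counit

/-- The map `H ⊗ (H ⊗ M) → H ⊗ M`, `x ⊗ (y ⊗ m) ↦ xy ⊗ m`. -/
noncomputable def mulFirst (k : Type*) [Field k] {H M : Type*} [Ring H] [Algebra k H]
    [AddCommGroup M] [Module k M] : H ⊗[k] (H ⊗[k] M) →ₗ[k] H ⊗[k] M :=
  TensorProduct.map (LinearMap.mul' k H) LinearMap.id ∘ₗ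
    (TensorProduct.assoc k H H M).symm.toLinearMap

/-- A left partial `H`-comodule coalgebra over a bialgebra `H`:
(PLHCC1) `(id ⊗ Δ)λ(c) = ∑ c₍₁₎⁽⁻¹⁾c₍₂₎⁽⁻¹⁾ ⊗ c₍₁₎⁽⁰⁾ ⊗ c₍₂₎⁽⁰⁾`;
(PLHCC2) `(ε ⊗ id)λ(c) = c`;
(PLHCC3) `(id ⊗ λ)λ(c) = ∑ c₍₁₎⁽⁻¹⁾ε(c₍₁₎⁽⁰⁾)(c₍₂₎⁽⁻¹⁾)₍₁₎ ⊗ (c₍₂₎⁽⁻¹⁾)₍₂₎ ⊗ c₍₂₎⁽⁰⁾`. -/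
structure IsPartialComoduleCoalgebra (k : Type*) [Field k] {H C : Type*} [Ring H] [Bialgebra k H]
    [AddCommGroup C] [Module k C] [Coalgebra k C] (lam : C →ₗ[k] H ⊗[k] C) : Prop where
  plhcc1 : ∀ c : C,
    TensorProduct.map LinearMap.id (Coalgebra.comul (R := k)) (lam c) =
    TensorProduct.map (LinearMap.mul' k H) LinearMap.id
      ((TensorProduct.tensorTensorTensorComm k H C H C)
        (TensorProduct.map lam lam (Coalgebra.comul (R := k) c)))
  plhcc2 : ∀ c : C,
    (TensorProduct.lid k C) (TensorProduct.map Coalgebra.counit LinearMap.id (lam c)) = c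
  plhcc3 : ∀ c : C,
    TensorProduct.map LinearMap.id lam (lam c) =
    mulFirst k (TensorProduct.map (psiHC k)
      ((TensorProduct.assoc k H H C).toLinearMap ∘ₗ
        TensorProduct.map (Coalgebra.comul (R := k)) LinearMap.id)
      (TensorProduct.map lam lam (Coalgebra.comul (R := k) c)))

/-- The symmetric axiom (PLHCC3') for a left partial `H`-comodule coalgebra:
`(id ⊗ λ)λ(c) = ∑ (c₍₁₎⁽⁻¹⁾)₍₁₎c₍₂₎⁽⁻¹⁾ε(c₍₂₎⁽⁰⁾) ⊗ (c₍₁₎⁽⁻¹⁾)₍₂₎ ⊗ c₍₁₎⁽⁰⁾`. -/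
def PLHCC3' (k : Type*) [Field k] {H C : Type*} [Ring H] [Bialgebra k H]
    [AddCommGroup C] [Module k C] [Coalgebra k C] (lam : C →ₗ[k] H ⊗[k] C) : Prop :=
  ∀ c : C,
    TensorProduct.map LinearMap.id lam (lam c) =
    mulFirst k ((TensorProduct.map LinearMap.id
        (TensorProduct.comm k (H ⊗[k] C) H).toLinearMap)
      ((TensorProduct.assoc k H (H ⊗[k] C) H)
        (TensorProduct.map
          ((TensorProduct.assoc k H H C).toLinearMap ∘ₗ
            TensorProduct.map (Coalgebra.comul (R := k)) LinearMap.id)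
          (psiHC k)
          (TensorProduct.map lam lam (Coalgebra.comul (R := k) c)))))
/-- A right partial `H`-module coalgebra: (PRHMC1) `Δ(c·h) = ∑ (c₍₁₎·h₍₁₎) ⊗ (c₍₂₎·h₍₂₎)`;
(PRHMC2) `c·1 = c`; (PRHMC3) `(c·g)·h = ∑ ε(c₍₁₎·g₍₁₎)(c₍₂₎·g₍₂₎h)`. -/
structure IsRightPartialModuleCoalgebra (k : Type*) [Field k] {H C : Type*}
    [Ring H] [Bialgebra k H] [AddCommGroup C] [Module k C] [Coalgebra k C]
    (ract : C →ₗ[k] H →ₗ[k] C) : Prop where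
  prhmc1 : ∀ (c : C) (h : H), Coalgebra.comul (R := k) (ract c h) =
    sw4 k (TensorProduct.lift ract) (TensorProduct.lift ract) c h
  prhmc2 : ∀ c : C, ract c 1 = c
  prhmc3 : ∀ (c : C) (g h : H), ract (ract c g) h =
    (TensorProduct.lid k C) (sw4 k
      (Coalgebra.counit ∘ₗ TensorProduct.lift ract)
      (TensorProduct.lift ract ∘ₗ TensorProduct.map LinearMap.id (LinearMap.mulRight k h)) c g)

/-- The symmetric axiom (PRHMC3') for a right partial `H`-module coalgebra:
`(c·g)·h = ∑ (c₍₁₎·g₍₁₎h)ε(c₍₂₎·g₍₂₎)`. -/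
def PRHMC3' (k : Type*) [Field k] {H C : Type*}
    [Ring H] [Bialgebra k H] [AddCommGroup C] [Module k C] [Coalgebra k C]
    (ract : C →ₗ[k] H →ₗ[k] C) : Prop :=
  ∀ (c : C) (g h : H), ract (ract c g) h =
    (TensorProduct.rid k C) (sw4 k
      (TensorProduct.lift ract ∘ₗ TensorProduct.map LinearMap.id (LinearMap.mulRight k h))
      (Coalgebra.counit ∘ₗ TensorProduct.lift ract) c g)

/-- The contraction `K ⊗ M → M`, `x ⊗ m ↦ f(x)m`, along a linear functional `f` on `K`. -/
noncomputable def contractFirst {k K M : Type*} [Field k] [AddCommGroup K] [Module k K]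
    [AddCommGroup M] [Module k M] (f : K →ₗ[k] k) : K ⊗[k] M →ₗ[k] M :=
  (TensorProduct.lid k M).toLinearMap ∘ₗ TensorProduct.map f LinearMap.id

section Contraction

variable {k K M N : Type*} [Field k] [AddCommGroup K] [Module k K]
  [AddCommGroup M] [Module k M] [AddCommGroup N] [Module k N]

theorem contractFirst_tmul (f : K →ₗ[k] k) (x : K) (m : M) :
    contractFirst f (x ⊗ₜ[k] m) = f x • m := by
  simp [contractFirst]

/-- Contraction is natural in the second tensor factor. -/
theorem contractFirst_map (f : K →ₗ[k] k) (φ : M →ₗ[k] N) (w : K ⊗[k] M) :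
    contractFirst f (TensorProduct.map LinearMap.id φ w) = φ (contractFirst f w) := by
  induction w with
  | zero => simp
  | tmul x m => simp [contractFirst_tmul]
  | add a b ha hb => simp only [map_add, ha, hb]

end Contraction

theorem sw2_eq_sum {k H A ι : Type*} [Field k] [AddCommGroup H] [Module k H] [Coalgebra k H]
    [Ring A] [Algebra k A] (f g : H →ₗ[k] A) {h : H} (r : Coalgebra.Repr k h ι) :
    sw2 k f g h = ∑ i ∈ r.index, f (r.left i) * g (r.right i) := by
  simp [sw2, ← r.eq, map_sum]

theorem sw4_eq_sum {k H C M N ι κ : Type*} [Field k]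
    [AddCommGroup H] [Module k H] [Coalgebra k H]
    [AddCommGroup C] [Module k C] [Coalgebra k C]
    [AddCommGroup M] [Module k M] [AddCommGroup N] [Module k N]
    (f₁ : H ⊗[k] C →ₗ[k] M) (f₂ : H ⊗[k] C →ₗ[k] N) {h : H} {c : C}
    (r : Coalgebra.Repr k h ι) (s : Coalgebra.Repr k c κ) :
    sw4 k f₁ f₂ h c = ∑ i ∈ r.index, ∑ j ∈ s.index,
      f₁ (r.left i ⊗ₜ[k] s.left j) ⊗ₜ[k] f₂ (r.right i ⊗ₜ[k] s.right j) := by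
  rw [Finset.sum_comm]
  simp only [sw4, ← r.eq, ← s.eq, TensorProduct.sum_tmul, TensorProduct.tmul_sum, map_sum,
    TensorProduct.tensorTensorTensorComm_tmul, TensorProduct.map_tmul]

section Pairing

variable {k H K C M N ι : Type*} [Field k] [Ring H] [HopfAlgebra k H] [Ring K] [HopfAlgebra k K]
  [AddCommGroup C] [Module k C] [Coalgebra k C]
  [AddCommGroup M] [Module k M] [AddCommGroup N] [Module k N]
  {p : H →ₗ[k] K →ₗ[k] k}

theorem IsHopfPairing.apply_mul (hp : IsHopfPairing k p) {h : H} (r : Coalgebra.Repr k h ι)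
    (x y : K) : p h (x * y) = ∑ i ∈ r.index, p (r.left i) x * p (r.right i) y := by
  rw [hp.mul_right, sw2_eq_sum _ _ r]
  rfl

/-- Contracting a product of first legs contracts each factor with a leg of `Δ(h)`. -/
theorem IsHopfPairing.contractFirst_mul (hp : IsHopfPairing k p) {h : H}
    (r : Coalgebra.Repr k h ι) (u : K ⊗[k] M) (v : K ⊗[k] N) :
    contractFirst (p h) (TensorProduct.map (LinearMap.mul' k K) LinearMap.id
      (TensorProduct.tensorTensorTensorComm k K M K N (u ⊗ₜ[k] v))) =
    ∑ i ∈ r.index, contractFirst (p (r.left i)) u ⊗ₜ[k] contractFirst (p (r.right i)) v := by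
  induction u with
  | zero => simp
  | add a b ha hb =>
    simp only [TensorProduct.add_tmul, map_add, ha, hb, Finset.sum_add_distrib]
  | tmul x m =>
    induction v with
    | zero => simp
    | add a b ha hb =>
      simp only [TensorProduct.tmul_add, map_add, ha, hb, Finset.sum_add_distrib]
    | tmul y n =>
      simp only [TensorProduct.tensorTensorTensorComm_tmul, TensorProduct.map_tmul,
        LinearMap.mul'_apply, LinearMap.id_apply, contractFirst_tmul, hp.apply_mul r,
        Finset.sum_smul, TensorProduct.smul_tmul_smul]

/-- Contracting `xy ⊗ m` along `⟨h, -⟩` when the second factor of the product varies in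
`K ⊗ M`. -/
theorem IsHopfPairing.contractFirst_mulFirst (hp : IsHopfPairing k p) {h : H}
    (r : Coalgebra.Repr k h ι) (x : K) (w : K ⊗[k] M) :
    contractFirst (p h) (mulFirst k (x ⊗ₜ[k] w)) =
    ∑ i ∈ r.index, p (r.left i) x • contractFirst (p (r.right i)) w := by
  induction w with
  | zero => simp
  | add a b ha hb =>
    simp only [TensorProduct.tmul_add, map_add, ha, hb, smul_add, Finset.sum_add_distrib]
  | tmul y m =>
    simp only [mulFirst, LinearMap.comp_apply, LinearEquiv.coe_coe,
      TensorProduct.assoc_symm_tmul, TensorProduct.map_tmul, LinearMap.mul'_apply,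
      LinearMap.id_apply, contractFirst_tmul, hp.apply_mul r, Finset.sum_smul, smul_smul]

/-- Contracting `xy ⊗ m` along `⟨h, -⟩` when the first factor of the product varies in
`K ⊗ M`. -/
theorem IsHopfPairing.contractFirst_mulFirst_comm (hp : IsHopfPairing k p) {h : H}
    (r : Coalgebra.Repr k h ι) (w : K ⊗[k] M) (y : K) :
    contractFirst (p h) (mulFirst k (TensorProduct.map LinearMap.id
      (TensorProduct.comm k M K).toLinearMap (TensorProduct.assoc k K M K (w ⊗ₜ[k] y)))) =
    ∑ i ∈ r.index, p (r.right i) y • contractFirst (p (r.left i)) w := by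
  induction w with
  | zero => simp
  | add a b ha hb =>
    simp only [TensorProduct.add_tmul, map_add, ha, hb, smul_add, Finset.sum_add_distrib]
  | tmul x m =>
    simp only [TensorProduct.assoc_tmul, TensorProduct.map_tmul, LinearEquiv.coe_coe,
      TensorProduct.comm_tmul, LinearMap.id_apply, hp.contractFirst_mulFirst r,
      contractFirst_tmul, smul_smul, mul_comm]

/-- Contracting the two legs of `Δ(x)` successively is contracting `x` with a product. -/
theorem IsHopfPairing.contractFirst_comul (hp : IsHopfPairing k p) (g h : H) (v : K ⊗[k] M) :
    contractFirst (p h) (contractFirst (p g) (TensorProduct.assoc k K K M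
      (TensorProduct.map (Coalgebra.comul (R := k)) LinearMap.id v))) =
    contractFirst (p (g * h)) v := by
  induction v with
  | zero => simp
  | add a b ha hb => simp only [map_add, ha, hb]
  | tmul x m =>
    have r := Coalgebra.Repr.arbitrary k x
    simp only [TensorProduct.map_tmul, ← r.eq, TensorProduct.sum_tmul, map_sum,
      TensorProduct.assoc_tmul, LinearMap.id_apply, contractFirst_tmul, map_smul, hp.mul_left,
      sw2_eq_sum _ _ r, Finset.sum_smul, smul_smul]

theorem apply_psiHC (f : K →ₗ[k] k) (u : K ⊗[k] C) :
    f (psiHC k u) = Coalgebra.counit (R := k) (contractFirst f u) := by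
  induction u with
  | zero => simp
  | add a b ha hb => simp only [map_add, ha, hb]
  | tmul x c => simp [psiHC, contractFirst_tmul, mul_comm]

end Pairing

/-- Let `⟨-,-⟩ : H ⊗ K → k` be a dual pairing of Hopf algebras and `C` a left partial
`K`-comodule coalgebra with coaction `λ(c) = c⁽⁻¹⁾ ⊗ c⁽⁰⁾`. Then `c·h := ⟨h, c⁽⁻¹⁾⟩c⁽⁰⁾`
makes `C` a right partial `H`-module coalgebra, i.e. it satisfies (PRHMC1), (PRHMC2) and
(PRHMC3); if moreover the partial coaction is symmetric (satisfies (PLHCC3')), then the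
partial action is symmetric (satisfies (PRHMC3')). -/
theorem partialComoduleCoalgebra_to_rightPartialModuleCoalgebra
    {k H K C : Type*} [Field k] [Ring H] [HopfAlgebra k H] [Ring K] [HopfAlgebra k K]
    [AddCommGroup C] [Module k C] [Coalgebra k C]
    (p : H →ₗ[k] K →ₗ[k] k) (hp : IsHopfPairing k p)
    (lam : C →ₗ[k] K ⊗[k] C) (hlam : IsPartialComoduleCoalgebra k lam)
    (ract : C →ₗ[k] H →ₗ[k] C)
    (hract : ∀ (c : C) (h : H),
      ract c h = (TensorProduct.lid k C) (TensorProduct.map (p h) LinearMap.id (lam c))) :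
    IsRightPartialModuleCoalgebra k ract ∧ (PLHCC3' k lam → PRHMC3' k ract) := by
  have act (c : C) (h : H) : ract c h = contractFirst (p h) (lam c) := hract c h
  have act_act (c : C) (g h : H) : ract (ract c g) h =
      contractFirst (p h) (contractFirst (p g) (TensorProduct.map LinearMap.id lam (lam c))) := by
    rw [contractFirst_map, act, act]
  refine ⟨⟨fun c h => ?_, fun c => ?_, fun c g h => ?_⟩, fun hsymm c g h => ?_⟩
  · have r := Coalgebra.Repr.arbitrary k h
    have s := Coalgebra.Repr.arbitrary k c
    rw [act, ← contractFirst_map, hlam.plhcc1, sw4_eq_sum _ _ s r]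
    simp only [← s.eq, map_sum, TensorProduct.map_tmul, hp.contractFirst_mul r,
      TensorProduct.lift.tmul, act]
  · have hone : p 1 = Coalgebra.counit := LinearMap.ext hp.one_left
    rw [hract, hone, hlam.plhcc2]
  · have r := Coalgebra.Repr.arbitrary k g
    have s := Coalgebra.Repr.arbitrary k c
    rw [act_act, hlam.plhcc3, sw4_eq_sum _ _ s r]
    simp only [← s.eq, map_sum, TensorProduct.map_tmul, hp.contractFirst_mulFirst r,
      LinearMap.comp_apply, LinearEquiv.coe_coe, map_smul, hp.contractFirst_comul, apply_psiHC,
      TensorProduct.lift.tmul, TensorProduct.lid_tmul, LinearMap.id_apply,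
      LinearMap.mulRight_apply, act]
  · have r := Coalgebra.Repr.arbitrary k g
    have s := Coalgebra.Repr.arbitrary k c
    rw [act_act, hsymm, sw4_eq_sum _ _ s r]
    simp only [← s.eq, map_sum, TensorProduct.map_tmul, hp.contractFirst_mulFirst_comm r,
      LinearMap.comp_apply, LinearEquiv.coe_coe, map_smul, hp.contractFirst_comul, apply_psiHC,
      TensorProduct.lift.tmul, TensorProduct.rid_tmul, LinearMap.id_apply,
      LinearMap.mulRight_apply, act]
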